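/- Let L ≥ 1 be an integer, let a, b : Fin L → Fin 4 be two sequences of bases, let k be the number of sites σ with a(σ) ≠ b(σ), and let r = k/L be the rate of site difference. Then for every t > 0, Σ_{σ=1}^{L} (Q·P(t))_{a(σ) b(σ)} / P(t)_{a(σ) b(σ)} = L·e^{−4t/3}·( r/(3·p₁(t)) − (1 − r)/p₀(t) ). -/

import Mathlib

noncomputable section

open Matrix

/-- The Jukes–Cantor rate matrix: −1 on the diagonal, 1/3 off the diagonal. -/
def Qjc : Matrix (Fin 4) (Fin 4) ℝ :=
  Matrix.of fun a b => if a = b then -1 else 1 / 3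

/-- Diagonal entry of the Jukes–Cantor transition matrix. -/
def p0 (t : ℝ) : ℝ := 1 / 4 + 3 / 4 * Real.exp (-(4 * t) / 3)

/-- Off-diagonal entry of the Jukes–Cantor transition matrix. -/
def p1 (t : ℝ) : ℝ := 1 / 4 - 1 / 4 * Real.exp (-(4 * t) / 3)

/-- The Jukes–Cantor transition matrix P(t). -/
def Pjc (t : ℝ) : Matrix (Fin 4) (Fin 4) ℝ :=
  Matrix.of fun a b => if a = b then p0 t else p1 t

theorem QP_entry (t : ℝ) (i j : Fin 4) : (Qjc * Pjc t) i j / Pjc t i j =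
    Real.exp (-(4 * t) / 3) / (3 * p1 t) * (if i ≠ j then 1 else 0)
      - Real.exp (-(4 * t) / 3) / p0 t * (1 - (if i ≠ j then 1 else 0)) := by
  have h : (Qjc * Pjc t) i j = if i = j then -Real.exp (-(4 * t) / 3)
      else Real.exp (-(4 * t) / 3) / 3 := by
    fin_cases i <;> fin_cases j <;>
      simp [Matrix.mul_apply, Fin.sum_univ_four, Qjc, Pjc, p0, p1] <;> ring
  rw [h]
  by_cases hij : i = j
  · simp [hij, Pjc, neg_div]
  · simp [hij, Pjc, div_div]

/-- The per-site sum of (Q·P(t))_{aσ bσ}/P(t)_{aσ bσ} equals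
L·e^{−4t/3}·(r/(3p₁(t)) − (1−r)/p₀(t)), where r is the rate of site
difference between the two sequences. -/
theorem jukes_cantor_gradient_sum (L : ℕ) (hL : 1 ≤ L) (a b : Fin L → Fin 4)
    (r : ℝ)
    (hr : r = ((Finset.univ.filter fun σ : Fin L => a σ ≠ b σ).card : ℝ) / L)
    (t : ℝ) (ht : 0 < t) :
    ∑ σ : Fin L, (Qjc * Pjc t) (a σ) (b σ) / Pjc t (a σ) (b σ) =
      L * Real.exp (-(4 * t) / 3) * (r / (3 * p1 t) - (1 - r) / p0 t) := by
  have hL0 : (L : ℝ) ≠ 0 := by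
    have : L ≠ 0 := by omega
    exact_mod_cast this
  have hk : ((Finset.univ.filter fun σ : Fin L => a σ ≠ b σ).card : ℝ) = L * r := by
    rw [hr]; field_simp
  simp_rw [QP_entry]
  rw [Finset.sum_sub_distrib, ← Finset.mul_sum, ← Finset.mul_sum, Finset.sum_sub_distrib,
    Finset.sum_boole, hk]
  simp only [Finset.sum_const, Finset.card_univ, Fintype.card_fin, nsmul_eq_mul, mul_one]
  ring
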